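/- Let I = (V,E,Q,Φ) be an MRF instance with n = |V| that satisfies the Dobrushin–Shlosman condition with constant δ > 0. Then for every ε ∈ (0,1), the mixing rate of the Gibbs sampling chain on I satisfies τ_mix(I,ε) ≤ ⌈(n/δ)·log(n/ε)⌉, where τ_mix(I,ε) = max over initial states X_0 ∈ Q^V of the least t such that d_TV(X_t, μ_I) ≤ ε, d_TV denoting total variation distance and μ_I the Gibbs distribution of I. -/

import Mathlib

open Finset
open scoped ENNReal

/-- Exponential on `ℝ ∪ {−∞}` (modeled as `WithBot ℝ`), with `exp(−∞) = 0`. -/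
noncomputable def expB (x : WithBot ℝ) : ℝ := WithBot.recBotCoe 0 Real.exp x

/-- Total variation distance between two distributions on a finite set. -/
noncomputable def tvDist {Q : Type*} [Fintype Q] (μ ν : Q → ℝ) : ℝ :=
  2⁻¹ * ∑ x, |μ x - ν x|

/-- `D` is a coupling of the distributions `μ` and `ν` on a finite set. -/
def IsCoupling {Q : Type*} [Fintype Q] (μ ν : Q → ℝ) (D : Q → Q → ℝ) : Prop :=
  (∀ c c', 0 ≤ D c c') ∧ (∀ c, ∑ c', D c c' = μ c) ∧ (∀ c', ∑ c, D c c' = ν c')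

/-- `D` is an optimal coupling of `μ` and `ν`: a coupling maximizing the probability
of agreement of the two coordinates. -/
def IsOptimalCoupling {Q : Type*} [Fintype Q] (μ ν : Q → ℝ) (D : Q → Q → ℝ) : Prop :=
  IsCoupling μ ν D ∧
    ∀ D' : Q → Q → ℝ, IsCoupling μ ν D' → ∑ c, D' c c ≤ ∑ c, D c c

/-- Distribution of a finite-state Markov chain with transition kernel `P` after `t` steps,
started from the initial distribution `init`. -/
noncomputable def chainDist {S : Type*} [Fintype S] (P : S → S → ℝ) (init : S → ℝ) :
    ℕ → S → ℝ
  | 0 => init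
  | t + 1 => fun s' => ∑ s, chainDist P init t s * P s s'

/-- Point mass at `s0`. -/
noncomputable def initDelta {S : Type*} [DecidableEq S] (s0 : S) : S → ℝ :=
  fun s => if s = s0 then 1 else 0

/-- Transition kernel of a coupled pair of single-site (Gibbs-sampling style) chains:
a uniformly random vertex `v` is picked, all other coordinates of both copies are copied,
and the pair of new values at `v` is drawn from the local coupling `Dloc v`. -/
noncomputable def pairKernel {V Q : Type*} [Fintype V] [Fintype Q]
    (Dloc : V → (V → Q) → (V → Q) → Q → Q → ℝ)
    (p p' : (V → Q) × (V → Q)) : ℝ := by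
  classical
  exact (Fintype.card V : ℝ)⁻¹ * ∑ v,
    (if (∀ u, u ≠ v → p'.1 u = p.1 u) ∧ (∀ u, u ≠ v → p'.2 u = p.2 u)
      then Dloc v p.1 p.2 (p'.1 v) (p'.2 v) else 0)

/-- The resampling probability `p(c)` used in the local coupling for Hamiltonian update. -/
noncomputable def pResample {Q : Type*} (μ μ' : Q → ℝ) (c : Q) : ℝ := by
  classical
  exact if μ c ≤ μ' c then 0 else (μ c - μ' c) / μ c

/-- The resampling distribution `ν` used in the local coupling for Hamiltonian update. -/
noncomputable def nuResample {Q : Type*} [Fintype Q] (μ μ' : Q → ℝ) (b : Q) : ℝ :=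
  max 0 (μ' b - μ b) / ∑ x, max 0 (μ x - μ' x)

/-- The joint law of the local coupling for Hamiltonian update: first `(c,c')` is drawn from
the optimal coupling `Dopt`, then with probability `pResample μ μ' c'` the second coordinate
is resampled from `nuResample μ μ'`. -/
noncomputable def hamCoupling {Q : Type*} [Fintype Q] (μ μ' : Q → ℝ)
    (Dopt : Q → Q → ℝ) (c d : Q) : ℝ :=
  Dopt c d * (1 - pResample μ μ' d) +
    nuResample μ μ' d * ∑ c', Dopt c c' * pResample μ μ' c'

/-- Indicator (as a real number) of the event `v ∈ Γ⁺(D)`, where `D` is the set of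
disagreements between the two coordinates of the pair state `p`. -/
noncomputable def indNbr {V Q : Type*} [Fintype V] (G : SimpleGraph V)
    (p : (V → Q) × (V → Q)) (v : V) : ℝ := by
  classical
  exact if (∃ u, (u = v ∨ G.Adj v u) ∧ p.1 u ≠ p.2 u) then 1 else 0

/-- `v` is incident to an edge of the symmetric difference of the edge sets of `G` and `G'`. -/
def inS {V : Type*} (G G' : SimpleGraph V) (v : V) : Prop :=
  ∃ u, (G.Adj v u ∧ ¬ G'.Adj v u) ∨ (G'.Adj v u ∧ ¬ G.Adj v u)

/-- Indicator (as a real number) of the event `v ∈ S ∪ Γ_G⁺(D)`. -/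
noncomputable def indSnbr {V Q : Type*} [Fintype V] (G G' : SimpleGraph V)
    (p : (V → Q) × (V → Q)) (v : V) : ℝ := by
  classical
  exact if inS G G' v ∨ (∃ u, (u = v ∨ G.Adj v u) ∧ p.1 u ≠ p.2 u) then 1 else 0

/-- Conditional marginal distribution `μ_{v,I}(·|τ)` of the MRF at vertex `v` given the
configuration `τ` on its neighborhood, where the MRF on the graph `G` has vertex potentials
`φ` and (symmetric) edge potentials `ψ` with values in `ℝ ∪ {−∞}`. -/
noncomputable def margW {V Q : Type*} [Fintype V] [Fintype Q]
    (G : SimpleGraph V) [DecidableRel G.Adj]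
    (φ : V → Q → WithBot ℝ) (ψ : V → V → Q → Q → WithBot ℝ)
    (v : V) (τ : V → Q) (c : Q) : ℝ :=
  expB (φ v c + ∑ u ∈ G.neighborFinset v, ψ u v (τ u) c) /
    ∑ a, expB (φ v a + ∑ u ∈ G.neighborFinset v, ψ u v (τ u) a)

/-- The influence matrix `A_I(u,v)`: the largest total variation distance between the
conditional marginals at `v` induced by two boundary configurations differing only at `u`,
when `{u,v}` is an edge, and `0` otherwise. -/
noncomputable def influence {V Q : Type*} [Fintype V] [Fintype Q]
    (G : SimpleGraph V) [DecidableRel G.Adj]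
    (φ : V → Q → WithBot ℝ) (ψ : V → V → Q → Q → WithBot ℝ) (u v : V) : ℝ := by
  classical
  exact if G.Adj u v then
      sSup {d : ℝ | ∃ σ τ : V → Q, (∀ w, w ≠ u → σ w = τ w) ∧
        d = tvDist (margW G φ ψ v σ) (margW G φ ψ v τ)}
    else 0

/-- The Dobrushin–Shlosman condition with constant `δ`. -/
def DobrushinCondition {V Q : Type*} [Fintype V] [Fintype Q]
    (G : SimpleGraph V) [DecidableRel G.Adj]
    (φ : V → Q → WithBot ℝ) (ψ : V → V → Q → Q → WithBot ℝ) (δ : ℝ) : Prop :=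
  ∀ u : V, ∑ v, influence G φ ψ u v ≤ 1 - δ

/-- The transition kernel of the Gibbs sampling (Glauber dynamics) chain on the MRF:
a uniformly random vertex is picked and its spin resampled from the conditional marginal. -/
noncomputable def gibbsStep {V Q : Type*} [Fintype V] [Fintype Q]
    (G : SimpleGraph V) [DecidableRel G.Adj]
    (φ : V → Q → WithBot ℝ) (ψ : V → V → Q → Q → WithBot ℝ)
    (σ σ' : V → Q) : ℝ := by
  classical
  exact (Fintype.card V : ℝ)⁻¹ *
    ∑ v, (if ∀ u, u ≠ v → σ' u = σ u then margW G φ ψ v σ (σ' v) else 0)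

/-- Unnormalized Gibbs weight `exp(H(σ))` of a configuration. -/
noncomputable def gibbsWeight {V Q : Type*} [Fintype V] [DecidableEq V] [Fintype Q]
    (G : SimpleGraph V) [DecidableRel G.Adj] [Fintype G.edgeSet]
    (φ : V → Q → WithBot ℝ) (ψ : V → V → Q → Q → WithBot ℝ)
    (hψsym : ∀ u v c c', ψ u v c c' = ψ v u c' c) (σ : V → Q) : ℝ :=
  expB ((∑ v, φ v (σ v)) +
    ∑ e ∈ G.edgeFinset,
      Sym2.lift ⟨fun u w => ψ u w (σ u) (σ w), fun u w => hψsym u w (σ u) (σ w)⟩ e)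

/-- The Gibbs distribution `μ_I` of the MRF. -/
noncomputable def gibbsMeasure {V Q : Type*} [Fintype V] [DecidableEq V] [Fintype Q]
    (G : SimpleGraph V) [DecidableRel G.Adj] [Fintype G.edgeSet]
    (φ : V → Q → WithBot ℝ) (ψ : V → V → Q → Q → WithBot ℝ)
    (hψsym : ∀ u v c c', ψ u v c c' = ψ v u c' c) (σ : V → Q) : ℝ :=
  gibbsWeight G φ ψ hψsym σ / ∑ σ' : V → Q, gibbsWeight G φ ψ hψsym σ'

/-- Distance `|x − y| ∈ [0,∞]` on `ℝ ∪ {−∞}`: `0` if both are `−∞`, `∞` if exactly one is. -/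
noncomputable def dB (x y : WithBot ℝ) : ℝ≥0∞ :=
  WithBot.recBotCoe (WithBot.recBotCoe (0 : ℝ≥0∞) (fun _ => (⊤ : ℝ≥0∞)) y)
    (fun r => WithBot.recBotCoe (⊤ : ℝ≥0∞) (fun s => ENNReal.ofReal |r - s|) y) x

/-- The contribution of vertex `v` to the Hamiltonian distance:
`‖φ_v − φ'_v‖₁ + Σ_{e = {u,v} ∈ E} ‖φ_e − φ'_e‖₁`. -/
noncomputable def dVert {V Q : Type*} [Fintype V] [Fintype Q]
    (G : SimpleGraph V) [DecidableRel G.Adj]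
    (φ φ' : V → Q → WithBot ℝ) (ψ ψ' : V → V → Q → Q → WithBot ℝ) (v : V) : ℝ≥0∞ :=
  (∑ c, dB (φ v c) (φ' v c)) +
    ∑ u ∈ G.neighborFinset v, ∑ c, ∑ c', dB (ψ u v c c') (ψ' u v c c')

/-- Hamiltonian distance `d_Ham(I,I') = Σ_v ‖φ_v − φ'_v‖₁ + Σ_{e∈E} ‖φ_e − φ'_e‖₁`
(the edge sum is written as half the sum over ordered adjacent pairs). -/
noncomputable def dHamiltonian {V Q : Type*} [Fintype V] [Fintype Q]
    (G : SimpleGraph V) [DecidableRel G.Adj]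
    (φ φ' : V → Q → WithBot ℝ) (ψ ψ' : V → V → Q → Q → WithBot ℝ) : ℝ≥0∞ :=
  (∑ v, ∑ c, dB (φ v c) (φ' v c)) +
    2⁻¹ * ∑ u, ∑ v ∈ G.neighborFinset u, ∑ c, ∑ c', dB (ψ u v c c') (ψ' u v c c')

/-- The filter probability `p̂_v = min{2(‖φ_v − φ'_v‖₁ + Σ_{e∋v} ‖φ_e − φ'_e‖₁), 1}`. -/
noncomputable def pHat {V Q : Type*} [Fintype V] [Fintype Q]
    (G : SimpleGraph V) [DecidableRel G.Adj]
    (φ φ' : V → Q → WithBot ℝ) (ψ ψ' : V → V → Q → Q → WithBot ℝ) (v : V) : ℝ :=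
  (min (2 * dVert G φ φ' ψ ψ' v) 1).toReal

section Exponential

lemma expB_nonneg (x : WithBot ℝ) : 0 ≤ expB x := by
  induction x with
  | bot => exact le_rfl
  | coe r => exact (Real.exp_pos r).le

lemma expB_pos_iff {x : WithBot ℝ} : 0 < expB x ↔ x ≠ ⊥ := by
  induction x with
  | bot => simp [expB]
  | coe r => simpa [expB] using Real.exp_pos r

lemma expB_add (x y : WithBot ℝ) : expB (x + y) = expB x * expB y := by
  induction x with
  | bot => simp [expB]
  | coe r =>
    induction y with
    | bot => simp [expB]
    | coe s =>
      rw [← WithBot.coe_add]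
      exact Real.exp_add r s

lemma withBot_sum_ne_bot {ι : Type*} {s : Finset ι} {f : ι → WithBot ℝ} :
    ∑ i ∈ s, f i ≠ ⊥ ↔ ∀ i ∈ s, f i ≠ ⊥ := by
  classical
  induction s using Finset.induction_on with
  | empty => simp
  | insert a s ha ih => simp [Finset.sum_insert ha, ih]

end Exponential

section TotalVariation

lemma tvDist_nonneg {Q : Type*} [Fintype Q] (μ ν : Q → ℝ) : 0 ≤ tvDist μ ν :=
  mul_nonneg (by norm_num) (Finset.sum_nonneg fun _ _ => abs_nonneg _)

/-- The difference of the means of `g` under two distributions is at most the total variation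
distance times the oscillation of `g`. -/
lemma abs_sum_sub_mul_le_tvDist_mul {Q : Type*} [Fintype Q] [Nonempty Q] {μ ν g : Q → ℝ}
    {L : ℝ} (hmass : ∑ c, μ c = ∑ c, ν c) (hg : ∀ a b, g a - g b ≤ L) :
    |∑ c, (μ c - ν c) * g c| ≤ tvDist μ ν * L := by
  obtain ⟨a, ha⟩ := Finite.exists_max g
  obtain ⟨b, hb⟩ := Finite.exists_min g
  have hcenter : ∑ c, (μ c - ν c) * g c = ∑ c, (μ c - ν c) * (g c - (g a + g b) / 2) := by
    simp only [mul_sub, Finset.sum_sub_distrib, ← Finset.sum_mul, sub_mul, hmass]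
    ring
  rw [hcenter]
  calc |∑ c, (μ c - ν c) * (g c - (g a + g b) / 2)|
      ≤ ∑ c, |μ c - ν c| * (L / 2) := by
        refine (Finset.abs_sum_le_sum_abs _ _).trans (Finset.sum_le_sum fun c _ => ?_)
        rw [abs_mul]
        refine mul_le_mul_of_nonneg_left ?_ (abs_nonneg _)
        rw [abs_le]
        have := hg a b
        have := ha c
        have := hb c
        constructor <;> linarith
    _ = tvDist μ ν * L := by
        rw [← Finset.sum_mul, tvDist]
        ring

end TotalVariation

/-- A function that changes by at most `L` under single-site updates changes by at most
`|V| * L` between any two configurations. -/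
lemma abs_sub_le_card_mul_of_update {V Q : Type*} [Fintype V] [DecidableEq V]
    {f : (V → Q) → ℝ} {L : ℝ} (hf : ∀ σ u a, |f (Function.update σ u a) - f σ| ≤ L)
    (σ τ : V → Q) : |f σ - f τ| ≤ Fintype.card V * L := by
  have key : ∀ s : Finset V, |f (s.piecewise σ τ) - f τ| ≤ s.card * L := by
    intro s
    induction s using Finset.induction_on with
    | empty => simp
    | insert v s hv ih =>
      rw [Finset.piecewise_insert, Finset.card_insert_of_notMem hv]
      have h := abs_sub_le (f (Function.update (s.piecewise σ τ) v (σ v)))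
        (f (s.piecewise σ τ)) (f τ)
      have := hf (s.piecewise σ τ) v (σ v)
      push_cast
      linarith
  simpa using key Finset.univ

section Chain

lemma sum_chainDist_mul {S : Type*} [Fintype S] (P : S → S → ℝ) (init f : S → ℝ) (t : ℕ) :
    ∑ s, chainDist P init t s * f s =
      ∑ s, init s * ((fun (g : S → ℝ) s => ∑ s', P s s' * g s')^[t] f) s := by
  induction t generalizing f with
  | zero => rfl
  | succ t ih =>
    rw [Function.iterate_succ_apply, ← ih]
    simp only [chainDist, Finset.sum_mul, Finset.mul_sum]
    rw [Finset.sum_comm]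
    simp only [mul_assoc]

lemma chainDist_of_stationary {S : Type*} [Fintype S] {P : S → S → ℝ} {μ : S → ℝ}
    (h : ∀ s', ∑ s, μ s * P s s' = μ s') (t : ℕ) : chainDist P μ t = μ := by
  induction t with
  | zero => rfl
  | succ t ih =>
    funext s'
    simp only [chainDist, ih, h]

end Chain

lemma sum_incident_edges {V Q : Type*} [Fintype V] [DecidableEq V] (G : SimpleGraph V)
    [DecidableRel G.Adj] [Fintype G.edgeSet] (ψ : V → V → Q → Q → WithBot ℝ)
    (hψsym : ∀ u v c c', ψ u v c c' = ψ v u c' c) (σ : V → Q) (v : V) :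
    ∑ e ∈ G.edgeFinset with v ∈ e,
        Sym2.lift ⟨fun u w => ψ u w (σ u) (σ w), fun u w => hψsym u w (σ u) (σ w)⟩ e =
      ∑ u ∈ G.neighborFinset v, ψ u v (σ u) (σ v) := by
  symm
  refine Finset.sum_bij (fun u _ => s(u, v)) ?_ ?_ ?_ ?_
  · intro u hu
    simpa [G.adj_comm] using hu
  · intro u _ w _ h
    exact Sym2.congr_left.mp h
  · intro e he
    induction e with
    | _ x y =>
      simp only [Finset.mem_filter, SimpleGraph.mem_edgeFinset, SimpleGraph.mem_edgeSet,
        Sym2.mem_iff] at he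
      obtain ⟨hadj, rfl | rfl⟩ := he
      · exact ⟨y, by simpa using hadj, Sym2.eq_swap⟩
      · exact ⟨x, by simpa using hadj.symm, rfl⟩
  · intro u _
    rfl

section Gibbs

variable {V Q : Type*} [Fintype V] [Fintype Q] (G : SimpleGraph V) [DecidableRel G.Adj]
  (φ : V → Q → WithBot ℝ) (ψ : V → V → Q → Q → WithBot ℝ)

lemma margW_nonneg (v : V) (τ : V → Q) (c : Q) : 0 ≤ margW G φ ψ v τ c :=
  div_nonneg (expB_nonneg _) (Finset.sum_nonneg fun _ _ => expB_nonneg _)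

lemma margW_congr {v : V} {σ τ : V → Q} (h : ∀ u, G.Adj v u → σ u = τ u) :
    margW G φ ψ v σ = margW G φ ψ v τ := by
  have hsum : ∀ c, ∑ u ∈ G.neighborFinset v, ψ u v (σ u) c =
      ∑ u ∈ G.neighborFinset v, ψ u v (τ u) c := fun c =>
    Finset.sum_congr rfl fun u hu => by rw [h u (by simpa using hu)]
  funext c
  simp only [margW, hsum]

lemma sum_margW {v : V} {τ : V → Q}
    (hpos : 0 < ∑ a, expB (φ v a + ∑ u ∈ G.neighborFinset v, ψ u v (τ u) a)) :
    ∑ c, margW G φ ψ v τ c = 1 := by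
  simp only [margW]
  rw [← Finset.sum_div, div_self hpos.ne']

lemma tvDist_margW_le_influence {u v : V} {σ τ : V → Q} (h : ∀ w, w ≠ u → σ w = τ w) :
    tvDist (margW G φ ψ v σ) (margW G φ ψ v τ) ≤ influence G φ ψ u v := by
  classical
  unfold influence
  split_ifs with hadj
  · refine le_csSup (Set.Finite.bddAbove ?_) ⟨σ, τ, h, rfl⟩
    refine (Set.finite_range fun p : (V → Q) × (V → Q) =>
      tvDist (margW G φ ψ v p.1) (margW G φ ψ v p.2)).subset ?_
    rintro d ⟨σ', τ', -, rfl⟩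
    exact ⟨(σ', τ'), rfl⟩
  · rw [margW_congr G φ ψ (τ := τ) fun w hw => h w (by rintro rfl; exact hadj hw.symm)]
    simp [tvDist]

lemma influence_nonneg (u v : V) : 0 ≤ influence G φ ψ u v := by
  unfold influence
  split_ifs
  · refine Real.sSup_nonneg ?_
    rintro d ⟨σ, τ, -, rfl⟩
    exact tvDist_nonneg _ _
  · exact le_rfl

lemma le_one_of_dobrushinCondition [Nonempty V] {δ : ℝ} (hDob : DobrushinCondition G φ ψ δ) :
    δ ≤ 1 := by
  have h := hDob (Classical.arbitrary V)
  have := Finset.sum_nonneg fun v (_ : v ∈ Finset.univ) =>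
    influence_nonneg G φ ψ (Classical.arbitrary V) v
  linarith

variable [DecidableEq V]

lemma sum_ite_eq_off_site [DecidableEq Q] (σ : V → Q) (v : V)
    [DecidablePred fun σ' : V → Q => ∀ u, u ≠ v → σ' u = σ u] (F : (V → Q) → ℝ) :
    ∑ σ' : V → Q, (if ∀ u, u ≠ v → σ' u = σ u then F σ' else 0) =
      ∑ c, F (Function.update σ v c) := by
  rw [← Finset.sum_filter]
  refine Finset.sum_bij' (fun σ' _ => σ' v) (fun c _ => Function.update σ v c) ?_ ?_ ?_ ?_ ?_
  · simp
  · intro c _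
    simp +contextual [Function.update_of_ne]
  · intro σ' h
    simp only [Finset.mem_filter, Finset.mem_univ, true_and] at h
    rw [Function.update_eq_iff]
    exact ⟨rfl, fun u hu => (h u hu).symm⟩
  · simp
  · intro σ' h
    simp only [Finset.mem_filter, Finset.mem_univ, true_and] at h
    congr 1
    rw [eq_comm, Function.update_eq_iff]
    exact ⟨rfl, fun u hu => (h u hu).symm⟩

lemma sum_gibbsStep_mul [DecidableEq Q] (f : (V → Q) → ℝ) (σ : V → Q) :
    ∑ σ', gibbsStep G φ ψ σ σ' * f σ' =
      (Fintype.card V : ℝ)⁻¹ *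
        ∑ v, ∑ c, margW G φ ψ v σ c * f (Function.update σ v c) := by
  classical
  simp only [gibbsStep, mul_assoc, ← Finset.mul_sum, Finset.sum_mul, ite_mul, zero_mul]
  rw [Finset.sum_comm]
  congr 1
  refine Finset.sum_congr rfl fun v _ => ?_
  rw [sum_ite_eq_off_site σ v fun σ' => margW G φ ψ v σ (σ' v) * f σ']
  simp

/-- A Gibbs update contracts the largest change under single-site updates. -/
lemma abs_sum_gibbsStep_mul_update_sub_le [Nonempty V] [DecidableEq Q] [Nonempty Q]
    (hpos : ∀ (v : V) (τ : V → Q),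
      0 < ∑ a, expB (φ v a + ∑ u ∈ G.neighborFinset v, ψ u v (τ u) a))
    {δ : ℝ} (hDob : DobrushinCondition G φ ψ δ) {f : (V → Q) → ℝ} {L : ℝ} (hL : 0 ≤ L)
    (hf : ∀ σ u a, |f (Function.update σ u a) - f σ| ≤ L) (σ : V → Q) (u : V) (a : Q) :
    |∑ σ', gibbsStep G φ ψ (Function.update σ u a) σ' * f σ' -
        ∑ σ', gibbsStep G φ ψ σ σ' * f σ'| ≤ (1 - δ / Fintype.card V) * L := by
  have hcard : (0 : ℝ) < Fintype.card V := by exact_mod_cast Fintype.card_pos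
  set τ := Function.update σ u a with hτ
  have hsite : ∀ v, |∑ c, margW G φ ψ v τ c * f (Function.update τ v c) -
      ∑ c, margW G φ ψ v σ c * f (Function.update σ v c)| ≤
        (L - if v = u then L else 0) + influence G φ ψ u v * L := by
    intro v
    have hsplit : ∑ c, margW G φ ψ v τ c * f (Function.update τ v c) -
        ∑ c, margW G φ ψ v σ c * f (Function.update σ v c) =
        ∑ c, margW G φ ψ v τ c * (f (Function.update τ v c) - f (Function.update σ v c)) +
        ∑ c, (margW G φ ψ v τ c - margW G φ ψ v σ c) * f (Function.update σ v c) := by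
      rw [← Finset.sum_sub_distrib, ← Finset.sum_add_distrib]
      exact Finset.sum_congr rfl fun c _ => by ring
    rw [hsplit]
    refine (abs_add_le _ _).trans (add_le_add ?_ ?_)
    · have hc : ∀ c, |f (Function.update τ v c) - f (Function.update σ v c)| ≤
          L - if v = u then L else 0 := by
        intro c
        by_cases hvu : v = u
        · subst hvu
          simp [hτ]
        · rw [hτ, Function.update_comm (Ne.symm hvu)]
          simpa [hvu] using hf (Function.update σ v c) u a
      refine (Finset.abs_sum_le_sum_abs _ _).trans ?_
      calc _ ≤ ∑ c, margW G φ ψ v τ c * (L - if v = u then L else 0) := by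
            refine Finset.sum_le_sum fun c _ => ?_
            rw [abs_mul, abs_of_nonneg (margW_nonneg G φ ψ v τ c)]
            exact mul_le_mul_of_nonneg_left (hc c) (margW_nonneg G φ ψ v τ c)
        _ = _ := by rw [← Finset.sum_mul, sum_margW G φ ψ (hpos v τ), one_mul]
    · refine (abs_sum_sub_mul_le_tvDist_mul (L := L) ?_ ?_).trans ?_
      · rw [sum_margW G φ ψ (hpos v τ), sum_margW G φ ψ (hpos v σ)]
      · intro b c
        have h := hf (Function.update σ v c) v b
        rw [Function.update_idem] at h
        exact (le_abs_self _).trans h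
      · refine mul_le_mul_of_nonneg_right (tvDist_margW_le_influence G φ ψ ?_) hL
        intro w hw
        exact Function.update_of_ne hw _ _
  rw [sum_gibbsStep_mul, sum_gibbsStep_mul, ← mul_sub, ← Finset.sum_sub_distrib, abs_mul,
    abs_of_pos (inv_pos.mpr hcard)]
  have htotal := (Finset.abs_sum_le_sum_abs _ Finset.univ).trans
    (Finset.sum_le_sum fun v _ => hsite v)
  have hsum : ∑ v, ((L - if v = u then L else 0) + influence G φ ψ u v * L) =
      Fintype.card V * L - L + (∑ v, influence G φ ψ u v) * L := by
    rw [Finset.sum_add_distrib, Finset.sum_sub_distrib, ← Finset.sum_mul]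
    simp
  rw [hsum] at htotal
  have hrow := mul_le_mul_of_nonneg_right (hDob u) hL
  calc _ ≤ (Fintype.card V : ℝ)⁻¹ * ((Fintype.card V - δ) * L) :=
        mul_le_mul_of_nonneg_left (by linarith) (inv_pos.mpr hcard).le
    _ = _ := by field_simp

lemma abs_iterate_update_sub_le [Nonempty V] [DecidableEq Q] [Nonempty Q]
    (hpos : ∀ (v : V) (τ : V → Q),
      0 < ∑ a, expB (φ v a + ∑ u ∈ G.neighborFinset v, ψ u v (τ u) a))
    {δ : ℝ} (hDob : DobrushinCondition G φ ψ δ) {f : (V → Q) → ℝ} {L : ℝ} (hL : 0 ≤ L)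
    (hf : ∀ σ u a, |f (Function.update σ u a) - f σ| ≤ L) (t : ℕ) (σ : V → Q) (u : V) (a : Q) :
    |((fun (g : (V → Q) → ℝ) s => ∑ s', gibbsStep G φ ψ s s' * g s')^[t] f)
          (Function.update σ u a) -
        ((fun (g : (V → Q) → ℝ) s => ∑ s', gibbsStep G φ ψ s s' * g s')^[t] f) σ| ≤
      (1 - δ / Fintype.card V) ^ t * L := by
  have hcard : (1 : ℝ) ≤ Fintype.card V := by exact_mod_cast Fintype.card_pos
  have hρ : 0 ≤ 1 - δ / Fintype.card V := by
    rw [sub_nonneg, div_le_one (by linarith)]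
    exact (le_one_of_dobrushinCondition G φ ψ hDob).trans hcard
  induction t generalizing σ u a with
  | zero => simpa using hf σ u a
  | succ t ih =>
    simp only [Function.iterate_succ_apply']
    refine (abs_sum_gibbsStep_mul_update_sub_le G φ ψ hpos hDob
      (mul_nonneg (pow_nonneg hρ t) hL) ih σ u a).trans_eq ?_
    ring

variable [Fintype G.edgeSet] (hψsym : ∀ u v c c', ψ u v c c' = ψ v u c' c)

/-- As a function of the spin at `v`, the Gibbs weight is proportional to the local weight. -/
lemma exists_gibbsWeight_update_eq (σ : V → Q) (v : V) :
    ∃ K : ℝ, ∀ c, gibbsWeight G φ ψ hψsym (Function.update σ v c) =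
      K * expB (φ v c + ∑ u ∈ G.neighborFinset v, ψ u v (σ u) c) := by
  refine ⟨expB ((∑ w ∈ Finset.univ.erase v, φ w (σ w)) + ∑ e ∈ G.edgeFinset with v ∉ e,
    Sym2.lift ⟨fun u w => ψ u w (σ u) (σ w), fun u w => hψsym u w (σ u) (σ w)⟩ e), fun c => ?_⟩
  have hv : ∑ w, φ w (Function.update σ v c w) =
      φ v c + ∑ w ∈ Finset.univ.erase v, φ w (σ w) := by
    rw [← Finset.add_sum_erase _ _ (Finset.mem_univ v), Function.update_self]
    congr 1
    refine Finset.sum_congr rfl fun w hw => ?_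
    rw [Function.update_of_ne (Finset.ne_of_mem_erase hw)]
  have hin : ∑ u ∈ G.neighborFinset v,
      ψ u v (Function.update σ v c u) (Function.update σ v c v) =
        ∑ u ∈ G.neighborFinset v, ψ u v (σ u) c := by
    refine Finset.sum_congr rfl fun u hu => ?_
    rw [Function.update_self, Function.update_of_ne]
    exact (G.ne_of_adj (by simpa using hu)).symm
  have hout : ∑ e ∈ G.edgeFinset with v ∉ e,
      Sym2.lift ⟨fun u w => ψ u w (Function.update σ v c u) (Function.update σ v c w),
        fun u w => hψsym u w _ _⟩ e =
      ∑ e ∈ G.edgeFinset with v ∉ e,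
        Sym2.lift ⟨fun u w => ψ u w (σ u) (σ w), fun u w => hψsym u w (σ u) (σ w)⟩ e := by
    refine Finset.sum_congr rfl fun e he => ?_
    induction e with
    | _ x y =>
      simp only [Finset.mem_filter, Sym2.mem_iff, not_or] at he
      simp only [Sym2.lift_mk]
      rw [Function.update_of_ne (Ne.symm he.2.1), Function.update_of_ne (Ne.symm he.2.2)]
  rw [gibbsWeight, hv, ← Finset.sum_filter_add_sum_filter_not G.edgeFinset (fun e => v ∈ e),
    sum_incident_edges G ψ hψsym, hin, hout, ← expB_add]
  congr 1
  abel

lemma exists_gibbsWeight_pos [Nonempty Q]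
    (hpos : ∀ (v : V) (τ : V → Q),
      0 < ∑ a, expB (φ v a + ∑ u ∈ G.neighborFinset v, ψ u v (τ u) a)) :
    ∃ σ, 0 < gibbsWeight G φ ψ hψsym σ := by
  have key : ∀ s : Finset V, ∃ σ : V → Q, ∀ v ∈ s, φ v (σ v) ≠ ⊥ ∧
      ∀ u, G.Adj v u → ψ u v (σ u) (σ v) ≠ ⊥ := by
    intro s
    induction s using Finset.induction_on with
    | empty => exact ⟨fun _ => Classical.arbitrary Q, by simp⟩
    | insert w s hw ih =>
      obtain ⟨σ, hσ⟩ := ih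
      obtain ⟨c, -, hc⟩ := Finset.exists_lt_of_sum_lt
        (by simpa using hpos w σ : ∑ _a : Q, (0 : ℝ) < _)
      rw [expB_pos_iff, WithBot.add_ne_bot, withBot_sum_ne_bot] at hc
      have hedge : ∀ u, G.Adj w u → ψ u w (σ u) c ≠ ⊥ := fun u hu => hc.2 u (by simpa using hu)
      refine ⟨Function.update σ w c, fun v hv => ?_⟩
      by_cases hvw : v = w
      · subst hvw
        rw [Function.update_self]
        refine ⟨hc.1, fun u hu => ?_⟩
        rw [Function.update_of_ne (G.ne_of_adj hu).symm]
        exact hedge u hu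
      · rw [Function.update_of_ne hvw]
        have hvs := hσ v (Finset.mem_of_mem_insert_of_ne hv hvw)
        refine ⟨hvs.1, fun u hu => ?_⟩
        by_cases huw : u = w
        · subst huw
          rw [Function.update_self, hψsym]
          exact hedge v hu.symm
        · rw [Function.update_of_ne huw]
          exact hvs.2 u hu
  obtain ⟨σ, hσ⟩ := key Finset.univ
  refine ⟨σ, expB_pos_iff.mpr ?_⟩
  rw [WithBot.add_ne_bot, withBot_sum_ne_bot, withBot_sum_ne_bot]
  refine ⟨fun v _ => (hσ v (Finset.mem_univ v)).1, fun e he => ?_⟩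
  induction e with
  | _ x y =>
    exact (hσ y (Finset.mem_univ y)).2 x (G.adj_symm (by simpa using he))

lemma sum_gibbsMeasure_mul_gibbsStep [Nonempty V] [DecidableEq Q]
    (hpos : ∀ (v : V) (τ : V → Q),
      0 < ∑ a, expB (φ v a + ∑ u ∈ G.neighborFinset v, ψ u v (τ u) a)) (σ' : V → Q) :
    ∑ σ, gibbsMeasure G φ ψ hψsym σ * gibbsStep G φ ψ σ σ' = gibbsMeasure G φ ψ hψsym σ' := by
  classical
  have hcard : (Fintype.card V : ℝ) ≠ 0 := by exact_mod_cast Fintype.card_ne_zero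
  have hsite : ∀ v, ∑ σ, gibbsWeight G φ ψ hψsym σ *
      (if ∀ u, u ≠ v → σ' u = σ u then margW G φ ψ v σ (σ' v) else 0) =
        gibbsWeight G φ ψ hψsym σ' := by
    intro v
    obtain ⟨K, hK⟩ := exists_gibbsWeight_update_eq G φ ψ hψsym σ' v
    have hself := hK (σ' v)
    rw [Function.update_eq_self] at hself
    have hmarg : ∀ c, margW G φ ψ v (Function.update σ' v c) = margW G φ ψ v σ' := fun c =>
      margW_congr G φ ψ fun u hu => Function.update_of_ne (G.ne_of_adj hu).symm _ _
    have hsymm : ∀ σ : V → Q, (∀ u, u ≠ v → σ' u = σ u) ↔ ∀ u, u ≠ v → σ u = σ' u :=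
      fun σ => forall₂_congr fun _ _ => eq_comm
    simp only [mul_ite, mul_zero, hsymm]
    rw [sum_ite_eq_off_site σ' v fun σ => gibbsWeight G φ ψ hψsym σ * margW G φ ψ v σ (σ' v)]
    simp only [hmarg, hK]
    rw [← Finset.sum_mul, ← Finset.mul_sum, hself, margW, mul_assoc,
      mul_div_cancel₀ _ (hpos v σ').ne']
  have hterm : ∀ σ, gibbsMeasure G φ ψ hψsym σ * gibbsStep G φ ψ σ σ' =
      (∑ σ, gibbsWeight G φ ψ hψsym σ)⁻¹ * (Fintype.card V : ℝ)⁻¹ *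
        ∑ v, gibbsWeight G φ ψ hψsym σ *
          (if ∀ u, u ≠ v → σ' u = σ u then margW G φ ψ v σ (σ' v) else 0) := by
    intro σ
    rw [gibbsMeasure, gibbsStep, ← Finset.mul_sum, div_eq_mul_inv]
    ring_nf
  simp only [hterm]
  rw [← Finset.mul_sum, Finset.sum_comm]
  simp only [hsite, Finset.sum_const, Finset.card_univ, nsmul_eq_mul, gibbsMeasure]
  field_simp

lemma tvDist_chainDist_gibbsMeasure_le [Nonempty V] [DecidableEq Q] [Nonempty Q]
    (hpos : ∀ (v : V) (τ : V → Q),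
      0 < ∑ a, expB (φ v a + ∑ u ∈ G.neighborFinset v, ψ u v (τ u) a))
    {δ : ℝ} (hDob : DobrushinCondition G φ ψ δ) (σ₀ : V → Q) (t : ℕ) :
    tvDist (chainDist (gibbsStep G φ ψ) (initDelta σ₀) t) (gibbsMeasure G φ ψ hψsym) ≤
      Fintype.card V * (1 - δ / Fintype.card V) ^ t := by
  set μ := gibbsMeasure G φ ψ hψsym with hμ
  set p := chainDist (gibbsStep G φ ψ) (initDelta σ₀) t with hp
  have hw : ∀ σ, 0 ≤ gibbsWeight G φ ψ hψsym σ := fun σ => expB_nonneg _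
  have hZ : 0 < ∑ σ, gibbsWeight G φ ψ hψsym σ := by
    obtain ⟨σ, hσ⟩ := exists_gibbsWeight_pos G φ ψ hψsym hpos
    exact Finset.sum_pos' (fun σ _ => hw σ) ⟨σ, Finset.mem_univ σ, hσ⟩
  have hμ0 : ∀ σ, 0 ≤ μ σ := fun σ => div_nonneg (hw σ) hZ.le
  have hμ1 : ∑ σ, μ σ = 1 := by
    simp only [hμ, gibbsMeasure]
    rw [← Finset.sum_div, div_self hZ.ne']
  set f : (V → Q) → ℝ := fun σ => if 0 ≤ p σ - μ σ then 1 else -1 with hf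
  have habs : ∀ σ, |p σ - μ σ| = p σ * f σ - μ σ * f σ := by
    intro σ
    simp only [hf]
    split_ifs with h
    · rw [abs_of_nonneg h]; ring
    · rw [abs_of_neg (not_le.mp h)]; ring
  have hosc : ∀ σ u a, |f (Function.update σ u a) - f σ| ≤ 2 := by
    intro σ u a
    simp only [hf]
    split_ifs <;> norm_num
  set F := (fun (g : (V → Q) → ℝ) s => ∑ s', gibbsStep G φ ψ s s' * g s')^[t] f with hF
  have hpf : ∑ σ, p σ * f σ = F σ₀ := by
    rw [hp, sum_chainDist_mul]
    simp [initDelta, hF]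
  have hμf : ∑ σ, μ σ * f σ = ∑ σ, μ σ * F σ := by
    rw [hF, ← sum_chainDist_mul, chainDist_of_stationary
      (sum_gibbsMeasure_mul_gibbsStep G φ ψ hψsym hpos)]
  have hdiff : ∑ σ, |p σ - μ σ| = ∑ σ, μ σ * (F σ₀ - F σ) := by
    simp only [habs, Finset.sum_sub_distrib, mul_sub, hpf, hμf, ← Finset.sum_mul, hμ1, one_mul]
  have hbound : ∑ σ, μ σ * (F σ₀ - F σ) ≤
      ∑ σ, μ σ * (Fintype.card V * ((1 - δ / Fintype.card V) ^ t * 2)) :=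
    Finset.sum_le_sum fun σ _ => mul_le_mul_of_nonneg_left ((le_abs_self _).trans
      (abs_sub_le_card_mul_of_update
        (abs_iterate_update_sub_le G φ ψ hpos hDob zero_le_two hosc t) σ₀ σ)) (hμ0 σ)
  rw [← Finset.sum_mul, hμ1, one_mul] at hbound
  rw [tvDist, hdiff]
  linarith

end Gibbs

/-- If the MRF instance `I` satisfies the Dobrushin–Shlosman condition with
constant `δ > 0`, then for every `ε ∈ (0,1)` the mixing rate of the Gibbs sampling chain on `I`
satisfies `τ_mix(I,ε) ≤ ⌈(n/δ)·log(n/ε)⌉`: for every initial state `σ0`, the least `t` such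
that the distribution of `X_t` is within total variation distance `ε` of the Gibbs
distribution `μ_I` is at most `⌈(n/δ)·log(n/ε)⌉`. -/
theorem dobrushin_mixing_time_bound
    {V Q : Type*} [Fintype V] [DecidableEq V] [Nonempty V]
    [Fintype Q] [DecidableEq Q] [Nonempty Q]
    (G : SimpleGraph V) [DecidableRel G.Adj] [Fintype G.edgeSet]
    (φ : V → Q → WithBot ℝ) (ψ : V → V → Q → Q → WithBot ℝ)
    (hψsym : ∀ u v c c', ψ u v c c' = ψ v u c' c)
    (hQ2 : 2 ≤ Fintype.card Q)
    (hpos : ∀ (v : V) (τ : V → Q),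
      0 < ∑ a, expB (φ v a + ∑ u ∈ G.neighborFinset v, ψ u v (τ u) a))
    (δ : ℝ) (hδ : 0 < δ)
    (hDob : DobrushinCondition G φ ψ δ) :
    ∀ ε : ℝ, 0 < ε → ε < 1 → ∀ σ0 : V → Q,
      sInf {t : ℕ |
          tvDist (chainDist (gibbsStep G φ ψ) (initDelta σ0) t)
              (gibbsMeasure G φ ψ hψsym) ≤ ε}
        ≤ ⌈((Fintype.card V : ℝ) / δ) * Real.log ((Fintype.card V : ℝ) / ε)⌉₊ := by
  intro ε hε _ σ0
  refine Nat.sInf_le ((tvDist_chainDist_gibbsMeasure_le G φ ψ hψsym hpos hDob σ0 _).trans ?_)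
  have hcard : (1 : ℝ) ≤ Fintype.card V := by exact_mod_cast Fintype.card_pos
  have hcard0 : (0 : ℝ) < Fintype.card V := by linarith
  set n : ℝ := (Fintype.card V : ℝ)
  set t := ⌈n / δ * Real.log (n / ε)⌉₊
  have hρ : 0 ≤ 1 - δ / n := by
    rw [sub_nonneg, div_le_one hcard0]
    exact (le_one_of_dobrushinCondition G φ ψ hDob).trans hcard
  have ht : Real.log (n / ε) ≤ t * (δ / n) := by
    have h := mul_le_mul_of_nonneg_right (Nat.le_ceil (n / δ * Real.log (n / ε)))
      (div_pos hδ hcard0).le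
    refine le_trans (le_of_eq ?_) h
    field_simp
  calc n * (1 - δ / n) ^ t ≤ n * Real.exp (-(δ / n)) ^ t := by
        gcongr
        exact Real.one_sub_le_exp_neg _
    _ = n * Real.exp (-(t * (δ / n))) := by rw [← Real.exp_nat_mul, mul_neg]
    _ ≤ n * Real.exp (-Real.log (n / ε)) := by gcongr
    _ = ε := by
        rw [Real.exp_neg, Real.exp_log (div_pos hcard0 hε)]
        field_simp
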